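/- arXiv:2508.12344 — 3 statements merged into one kernel-verified Lean document; each statement's English description precedes it below -/
import Mathlib

section
/- For every deterministic general PCFA A and every specification (φₑ, φ_f), the MDP-view violation probability is bounded by the trace-view violation probability of its accepted trace set: ℙ_MDP(A ⊨ (φₑ, φ_f)) ≤ traceProb(ℒ(A); φₑ, φ_f). -/
open Classical

/-! ### Basic syntax: expressions, predicates, statements -/

inductive Dir : Type
  | L : Dir
  | R : Dir
  deriving DecidableEq

inductive AExp (V : Type) : Type
  | var : V → AExp V
  | const : ℕ → AExp V
  | add : AExp V → AExp V → AExp V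
  | mul : AExp V → AExp V → AExp V
  | sub : AExp V → AExp V → AExp V

inductive BExp (V : Type) : Type
  | eq : AExp V → AExp V → BExp V
  | le : AExp V → AExp V → BExp V
  | lt : AExp V → AExp V → BExp V
  | not : BExp V → BExp V
  | and : BExp V → BExp V → BExp V
  | or : BExp V → BExp V → BExp V
  | imp : BExp V → BExp V → BExp V

variable {V : Type}

def AExp.eval (f : V → ℕ) : AExp V → ℕ
  | .var X => f X
  | .const n => n
  | .add a b => a.eval f + b.eval f
  | .mul a b => a.eval f * b.eval f
  | .sub a b => a.eval f - b.eval f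

def BExp.eval (f : V → ℕ) : BExp V → Bool
  | .eq a b => decide (a.eval f = b.eval f)
  | .le a b => decide (a.eval f ≤ b.eval f)
  | .lt a b => decide (a.eval f < b.eval f)
  | .not b => ! b.eval f
  | .and a b => a.eval f && b.eval f
  | .or a b => a.eval f || b.eval f
  | .imp a b => (! a.eval f) || b.eval f

/-- A valuation is `Option (V → ℕ)`; `none` is the dead valuation ⊥.
Satisfaction `v ⊨ φ`: ⊥ satisfies no predicate. -/
def BExp.sat (v : Option (V → ℕ)) (φ : BExp V) : Prop :=
  ∃ f, v = some f ∧ φ.eval f = true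

inductive Stmt (V : Type) : Type
  | skip : Stmt V
  | assign : V → AExp V → Stmt V
  | assume : BExp V → Stmt V
  | prob : ℕ → Dir → Stmt V
  | nondet : ℕ → Stmt V

def Stmt.isProb : Stmt V → Bool
  | .prob _ _ => true
  | _ => false

/-- Evaluation of a statement on a valuation. -/
def Stmt.eval [DecidableEq V] (σ : Stmt V) : Option (V → ℕ) → Option (V → ℕ)
  | none => none
  | some f =>
    match σ with
    | Stmt.assign X E => some (Function.update f X (E.eval f))
    | Stmt.assume B => if B.eval f = true then some f else none
    | _ => some f

/-- Evaluation of a trace: `⟦σ₁⋯σₙ⟧ = ⟦σₙ⟧ ∘ ⋯ ∘ ⟦σ₁⟧`. -/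
def traceEval [DecidableEq V] (τ : List (Stmt V)) (v : Option (V → ℕ)) : Option (V → ℕ) :=
  τ.foldl (fun w σ => σ.eval w) v

/-- The weight of a trace: `(1/2)^k` where `k` is the number of probabilistic statements. -/
noncomputable def wt (τ : List (Stmt V)) : ENNReal :=
  (2⁻¹ : ENNReal) ^ (τ.countP Stmt.isProb)

/-- A trace is violating w.r.t. `(φe, φf)` if some valuation `v ⊨ φe` has `⟦τ⟧(v) ⊨ ¬φf`. -/
def Violating [DecidableEq V] (φe φf : BExp V) (τ : List (Stmt V)) : Prop :=
  ∃ v : Option (V → ℕ), BExp.sat v φe ∧ BExp.sat (traceEval τ v) (BExp.not φf)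

/-! ### Automata -/

/-- Underlying automaton data: statements label transitions. -/
structure PAuto (V : Type) : Type 1 where
  Loc : Type
  trans : Loc → Stmt V → Loc → Prop
  init : Loc
  ending : Set Loc

namespace PAuto

variable (A : PAuto V)

inductive Path : A.Loc → List (Stmt V) → A.Loc → Prop
  | nil (l : A.Loc) : Path l [] l
  | cons {l l' l'' : A.Loc} {σ : Stmt V} {τ : List (Stmt V)} :
      A.trans l σ l' → Path l' τ l'' → Path l (σ :: τ) l''

/-- Accepting traces: nonempty words labelling paths from the initial to an ending location. -/
def lang : Set (List (Stmt V)) :=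
  {τ | τ ≠ [] ∧ ∃ l ∈ A.ending, A.Path A.init τ l}

def Det : Prop :=
  ∀ ⦃l : A.Loc⦄ ⦃σ : Stmt V⦄ ⦃l₁ l₂ : A.Loc⦄, A.trans l σ l₁ → A.trans l σ l₂ → l₁ = l₂

/-- All transitions of `A` are labelled by statements in the alphabet `alph`. -/
def Over (alph : Finset (Stmt V)) : Prop :=
  ∀ ⦃l : A.Loc⦄ ⦃σ : Stmt V⦄ ⦃l' : A.Loc⦄, A.trans l σ l' → σ ∈ alph

/-- A general PCFA over a finite statement alphabet: finitely many locations. -/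
structure IsGPCFA (alph : Finset (Stmt V)) : Prop where
  finLoc : Finite A.Loc
  over_alph : A.Over alph

/-- A PCFA: deterministic general PCFA with a single ending location without out-transitions. -/
structure IsPCFA (alph : Finset (Stmt V)) : Prop where
  finLoc : Finite A.Loc
  over_alph : A.Over alph
  det : A.Det
  ending_unique : ∃ le : A.Loc, A.ending = {le}
  ending_no_out : ∀ l ∈ A.ending, ∀ (σ : Stmt V) (l' : A.Loc), ¬ A.trans l σ l'

/-- Normalisation condition: `Pb(i,L)` and `Pb(i,R)` out of the same location have
distinct targets. -/
def NormCond : Prop :=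
  ∀ ⦃l l₁ l₂ : A.Loc⦄ ⦃i : ℕ⦄,
    A.trans l (Stmt.prob i Dir.L) l₁ → A.trans l (Stmt.prob i Dir.R) l₂ → l₁ ≠ l₂

/-- A single-action automaton: deterministic, and from each location either all outgoing
transitions carry one common non-probabilistic statement, or all carry probabilistic
statements with one common distribution tag. (Locations may be infinite.) -/
def SingleAction : Prop :=
  A.Det ∧ ∀ q : A.Loc,
    (∃ σ : Stmt V, σ.isProb = false ∧
      ∀ ⦃σ' : Stmt V⦄ ⦃q' : A.Loc⦄, A.trans q σ' q' → σ' = σ) ∨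
    (∃ i : ℕ, ∀ ⦃σ' : Stmt V⦄ ⦃q' : A.Loc⦄, A.trans q σ' q' → ∃ d : Dir, σ' = Stmt.prob i d)

end PAuto

/-! ### Policies and the MDP view -/

inductive Act (V : Type) : Type
  | stmt : Stmt V → Act V
  | tag : ℕ → Act V

/-- The action associated to a statement: probabilistic statements give their tag. -/
def Stmt.act : Stmt V → Act V
  | .prob i _ => .tag i
  | σ => .stmt σ

/-- A policy: a (possibly infinite) set of policy states, a partial selection function,
and an initial policy state. -/
structure Policy (A : PAuto V) : Type 1 where
  S : Type
  sel : A.Loc → S → Option (Act V × S)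
  s₀ : S

/-- Applying a policy to an automaton. -/
def PAuto.applyPolicy (A : PAuto V) (ψ : Policy A) : PAuto V where
  Loc := A.Loc × ψ.S
  trans := fun p σ p' => A.trans p.1 σ p'.1 ∧ ψ.sel p.1 p.2 = some (σ.act, p'.2)
  init := (A.init, ψ.s₀)
  ending := {p | p.1 ∈ A.ending}

/-- MDP-view violation probability. -/
noncomputable def mdpProb [DecidableEq V] (A : PAuto V) (φe φf : BExp V) : ENNReal :=
  ⨆ (v : Option (V → ℕ)) (_ : BExp.sat v φe) (ψ : Policy A),
    ∑' τ : (A.applyPolicy ψ).lang,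
      wt τ.1 * (if BExp.sat (traceEval τ.1 v) (BExp.not φf) then 1 else 0)

/-- The structural upper bound. -/
noncomputable def structBound (A : PAuto V) : ENNReal :=
  ⨆ ψ : Policy A, ∑' τ : (A.applyPolicy ψ).lang, wt τ.1

/-! ### Operational semantics: computations and schedulers -/

/-- A transition with this statement is enabled at valuation `f`. -/
def Stmt.enabledAt (σ : Stmt V) (f : V → ℕ) : Prop :=
  ∀ B : BExp V, σ = Stmt.assume B → B.eval f = true

/-- Successor valuation of an enabled transition. -/
def Stmt.stepVal [DecidableEq V] (σ : Stmt V) (f : V → ℕ) : V → ℕ :=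
  match σ with
  | .assign X E => Function.update f X (E.eval f)
  | _ => f

/-- `A.Run l f τ l' f'`: a computation from program state `(l, f)` to `(l', f')`
along enabled transitions labelled `τ`. -/
inductive PAuto.Run [DecidableEq V] (A : PAuto V) :
    A.Loc → (V → ℕ) → List (Stmt V) → A.Loc → (V → ℕ) → Prop
  | nil (l : A.Loc) (f : V → ℕ) : A.Run l f [] l f
  | cons {l : A.Loc} {f : V → ℕ} {σ : Stmt V} {l' l'' : A.Loc} {τ : List (Stmt V)}
      {f'' : V → ℕ} :
      A.trans l σ l' → σ.enabledAt f → A.Run l' (σ.stepVal f) τ l'' f'' →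
      A.Run l f (σ :: τ) l'' f''

/-- An automaton scheduler for initial valuation `v₀`: to each non-terminating computation
(identified with its trace) it assigns the support of one of the three permitted
(sub-)distributions over enabled transitions: (a) Dirac on an enabled non-probabilistic
transition; (b) the fair Bernoulli on `Pb(i,L)`,`Pb(i,R)`; (c) mass 1/2 on a single
probabilistic transition. The weights of computations are independent of the scheduler, so
only the support matters. -/
structure Sched [DecidableEq V] (A : PAuto V) (v₀ : V → ℕ) : Type where
  supp : List (Stmt V) → Set (Stmt V)
  valid : ∀ (τ : List (Stmt V)) (l : A.Loc) (f : V → ℕ),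
    A.Run A.init v₀ τ l f → l ∉ A.ending →
    (∃ (σ : Stmt V) (l' : A.Loc), σ.isProb = false ∧ A.trans l σ l' ∧ σ.enabledAt f ∧
        supp τ = {σ}) ∨
    (∃ (i : ℕ) (lL lR : A.Loc), A.trans l (Stmt.prob i Dir.L) lL ∧
        A.trans l (Stmt.prob i Dir.R) lR ∧
        supp τ = {Stmt.prob i Dir.L, Stmt.prob i Dir.R}) ∨
    (∃ (i : ℕ) (d : Dir) (l' : A.Loc), A.trans l (Stmt.prob i d) l' ∧
        supp τ = {Stmt.prob i d})

/-- A computation (trace) is guided by a scheduler if each step uses a transition in the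
support assigned to the preceding prefix. -/
def Sched.Guided [DecidableEq V] {A : PAuto V} {v₀ : V → ℕ} (ξ : Sched A v₀)
    (τ : List (Stmt V)) : Prop :=
  ∀ (ρ w : List (Stmt V)) (σ : Stmt V), τ = ρ ++ σ :: w → σ ∈ ξ.supp ρ

/-- The standard violation probability. -/
noncomputable def stdProb [DecidableEq V] (A : PAuto V) (φe φf : BExp V) : ENNReal :=
  ⨆ (v₀ : V → ℕ) (_ : φe.eval v₀ = true) (ξ : Sched A v₀),
    ∑' τ : {τ : List (Stmt V) // ξ.Guided τ ∧
        ∃ (l : A.Loc) (f : V → ℕ), A.Run A.init v₀ τ l f ∧ l ∈ A.ending ∧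
          φf.eval f = false},
      wt τ.1

/-! ### Trace view -/

/-- A set of traces is mergeable if it is the language of a single-action automaton
(over a finite statement alphabet). -/
def Mergeable (Ts : Set (List (Stmt V))) : Prop :=
  ∃ M : PAuto V, (∃ alph : Finset (Stmt V), M.Over alph) ∧ M.SingleAction ∧ M.lang = Ts

/-- The trace-view violation probability of a set of traces. -/
noncomputable def traceProb [DecidableEq V] (Θ : Set (List (Stmt V))) (φe φf : BExp V) :
    ENNReal :=
  ⨆ (v : Option (V → ℕ)) (_ : BExp.sat v φe)
    (P : Set (List (Stmt V))) (_ : P ⊆ Θ) (_ : Mergeable P),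
    ∑' τ : P, wt τ.1 * (if BExp.sat (traceEval τ.1 v) (BExp.not φf) then 1 else 0)

/-! ### Substitution and weakest pre-conditions -/

def AExp.subst [DecidableEq V] (X : V) (E : AExp V) : AExp V → AExp V
  | .var Y => if Y = X then E else .var Y
  | .const n => .const n
  | .add a b => .add (AExp.subst X E a) (AExp.subst X E b)
  | .mul a b => .mul (AExp.subst X E a) (AExp.subst X E b)
  | .sub a b => .sub (AExp.subst X E a) (AExp.subst X E b)

def BExp.subst [DecidableEq V] (X : V) (E : AExp V) : BExp V → BExp V
  | .eq a b => .eq (AExp.subst X E a) (AExp.subst X E b)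
  | .le a b => .le (AExp.subst X E a) (AExp.subst X E b)
  | .lt a b => .lt (AExp.subst X E a) (AExp.subst X E b)
  | .not b => .not (BExp.subst X E b)
  | .and a b => .and (BExp.subst X E a) (BExp.subst X E b)
  | .or a b => .or (BExp.subst X E a) (BExp.subst X E b)
  | .imp a b => .imp (BExp.subst X E a) (BExp.subst X E b)

/-- Weakest pre-condition of a statement. -/
def wp [DecidableEq V] (σ : Stmt V) (φ : BExp V) : BExp V :=
  match σ with
  | .assign X E => φ.subst X E
  | .assume B => .imp B φ
  | _ => φ

/-! ### Prefix-free languages -/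

/-- A set of words is prefix-free: no element is a proper prefix of another element. -/
def PrefixFree {α : Type} (L : Set (List α)) : Prop :=
  ∀ u ∈ L, ∀ v ∈ L, u <+: v → u = v


theorem Stmt.act_eq_stmt {V : Type} {σ σ' : Stmt V} (h : σ'.act = Act.stmt σ) :
    σ' = σ ∧ σ'.isProb = false := by
  cases σ' <;> simp_all [Stmt.act, Stmt.isProb]

theorem Stmt.act_eq_tag {V : Type} {i : ℕ} {σ' : Stmt V} (h : σ'.act = Act.tag i) :
    ∃ d : Dir, σ' = Stmt.prob i d := by
  cases σ' <;> simp_all [Stmt.act]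

theorem PAuto.applyPolicy_singleAction {V : Type} (A : PAuto V) (hdet : A.Det) (ψ : Policy A) :
    (A.applyPolicy ψ).SingleAction := by
  refine ⟨?_, ?_⟩
  · rintro p σ p₁ p₂ ⟨h1, h2⟩ ⟨h3, h4⟩
    refine Prod.ext (hdet h1 h3) ?_
    rw [h2] at h4
    simpa using h4
  · intro p
    rcases hs : ψ.sel p.1 p.2 with _ | ⟨a, s⟩
    · refine Or.inl ⟨Stmt.skip, rfl, ?_⟩
      rintro σ' q' ⟨_, h⟩
      rw [hs] at h
      cases h
    · cases a with
      | tag i =>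
        refine Or.inr ⟨i, ?_⟩
        rintro σ' q' ⟨_, h⟩
        rw [hs] at h
        simp only [Option.some.injEq, Prod.mk.injEq] at h
        exact Stmt.act_eq_tag h.1.symm
      | stmt σ =>
        have key : ∀ ⦃σ' : Stmt V⦄ ⦃q' : (A.applyPolicy ψ).Loc⦄,
            (A.applyPolicy ψ).trans p σ' q' → σ' = σ ∧ σ'.isProb = false := by
          rintro σ' q' ⟨_, h⟩
          rw [hs] at h
          simp only [Option.some.injEq, Prod.mk.injEq] at h
          exact Stmt.act_eq_stmt h.1.symm
        by_cases hp : σ.isProb = false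
        · exact Or.inl ⟨σ, hp, fun σ' q' h => (key h).1⟩
        · refine Or.inl ⟨Stmt.skip, rfl, fun σ' q' h => ?_⟩
          obtain ⟨h1, h2⟩ := key h
          exact absurd (h1 ▸ h2) hp

theorem PAuto.applyPolicy_path {V : Type} (A : PAuto V) (ψ : Policy A)
    {p q : (A.applyPolicy ψ).Loc} {τ : List (Stmt V)} (h : (A.applyPolicy ψ).Path p τ q) :
    A.Path p.1 τ q.1 := by
  induction h with
  | nil l => exact .nil _
  | cons h _ ih => exact .cons h.1 ih

/-- For every deterministic general PCFA, the MDP-view violation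
probability is bounded by the trace-view violation probability of its language. -/
theorem mdpProb_le_traceProb {V : Type} [DecidableEq V]
    (A : PAuto V) (alph : Finset (Stmt V))
    (hfin : Finite A.Loc) (hover : A.Over alph) (hdet : A.Det)
    (φe φf : BExp V) :
    mdpProb A φe φf ≤ traceProb A.lang φe φf := by
  unfold mdpProb traceProb
  refine iSup_mono fun v => iSup_mono fun hv => iSup_le fun ψ => ?_
  refine le_iSup_of_le (A.applyPolicy ψ).lang (le_iSup_of_le ?_ (le_iSup_of_le ?_ le_rfl))
  · rintro τ ⟨hne, l, hl, hp⟩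
    exact ⟨hne, l.1, hl, A.applyPolicy_path ψ hp⟩
  · exact ⟨A.applyPolicy ψ, ⟨alph, fun _ _ _ h => hover h.1⟩,
      A.applyPolicy_singleAction hdet ψ, rfl⟩
end

section
/- Let A₁ and A₂ be deterministic general PCFA over the same finite statement set with the same set of accepting traces, ℒ(A₁) = ℒ(A₂). Then for every specification (φₑ, φ_f), ℙ_MDP(A₁ ⊨ (φₑ, φ_f)) = ℙ_MDP(A₂ ⊨ (φₑ, φ_f)), and moreover structBound(A₁) = structBound(A₂). -/
open Classical

variable {V : Type}

/-- Left derivative of a language. -/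
def lderiv (K : Set (List (Stmt V))) (σ : Stmt V) : Set (List (Stmt V)) := {τ | σ :: τ ∈ K}

/-- Weight of a single statement. -/
noncomputable def wt1 (σ : Stmt V) : ENNReal := if σ.isProb = true then 2⁻¹ else 1

theorem wt_cons (σ : Stmt V) (τ : List (Stmt V)) : wt (σ :: τ) = wt1 σ * wt τ := by
  unfold wt wt1
  by_cases h : σ.isProb = true
  · simp [List.countP_cons, h, pow_succ, mul_comm]
  · simp [List.countP_cons, h]

/-- Immediate reward. -/
noncomputable def rew (c : Option (V → ℕ) → ENNReal) (K : Set (List (Stmt V)))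
    (v : Option (V → ℕ)) : ENNReal := if [] ∈ K then c v else 0

/-- Weighted sum over the nonempty words of length at most `n`. -/
noncomputable def langSum [DecidableEq V] (c : Option (V → ℕ) → ENNReal) (n : ℕ)
    (K : Set (List (Stmt V))) (v : Option (V → ℕ)) : ENNReal :=
  ∑' τ : List (Stmt V), if τ ∈ K ∧ τ ≠ [] ∧ τ.length ≤ n then wt τ * c (traceEval τ v) else 0

/-- Finite-horizon optimal value of a language. -/
noncomputable def optVal [DecidableEq V] (c : Option (V → ℕ) → ENNReal) :
    ℕ → Set (List (Stmt V)) → Option (V → ℕ) → ENNReal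
  | 0, _, _ => 0
  | n + 1, K, v => ⨆ a : Act V, ∑' σ : Stmt V, if σ.act = a then
      wt1 σ * (rew c (lderiv K σ) (σ.eval v) + optVal c n (lderiv K σ) (σ.eval v)) else 0

/-- Value of playing one action, then optimally. -/
noncomputable def actVal [DecidableEq V] (c : Option (V → ℕ) → ENNReal) (n : ℕ)
    (K : Set (List (Stmt V))) (v : Option (V → ℕ)) (a : Act V) : ENNReal :=
  ∑' σ : Stmt V, if σ.act = a then
      wt1 σ * (rew c (lderiv K σ) (σ.eval v) + optVal c n (lderiv K σ) (σ.eval v)) else 0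

theorem optVal_succ [DecidableEq V] (c : Option (V → ℕ) → ENNReal) (n : ℕ)
    (K : Set (List (Stmt V))) (v : Option (V → ℕ)) :
    optVal c (n + 1) K v = ⨆ a : Act V, actVal c n K v a := rfl

theorem lderiv_empty (σ : Stmt V) : lderiv (∅ : Set (List (Stmt V))) σ = ∅ := rfl

theorem rew_empty (c : Option (V → ℕ) → ENNReal) (v : Option (V → ℕ)) :
    rew c (∅ : Set (List (Stmt V))) v = 0 := by simp [rew]

theorem langSum_empty [DecidableEq V] (c : Option (V → ℕ) → ENNReal) (n : ℕ)
    (v : Option (V → ℕ)) : langSum c n ∅ v = 0 := by simp [langSum]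

theorem optVal_empty [DecidableEq V] (c : Option (V → ℕ) → ENNReal) (n : ℕ) :
    ∀ v : Option (V → ℕ), optVal c n ∅ v = 0 := by
  induction n with
  | zero => intro v; rfl
  | succ n ih =>
    intro v
    rw [optVal_succ]
    simp [actVal, lderiv_empty, rew_empty, ih]

theorem langSum_zero [DecidableEq V] (c : Option (V → ℕ) → ENNReal)
    (K : Set (List (Stmt V))) (v : Option (V → ℕ)) : langSum c 0 K v = 0 := by
  unfold langSum
  rw [ENNReal.tsum_eq_zero]
  intro τ
  rw [if_neg]
  rintro ⟨_, h, h'⟩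
  exact h (List.length_eq_zero_iff.mp (Nat.le_zero.mp h'))

theorem langSum_succ [DecidableEq V] (c : Option (V → ℕ) → ENNReal) (n : ℕ)
    (K : Set (List (Stmt V))) (v : Option (V → ℕ)) :
    langSum c (n + 1) K v = ∑' σ : Stmt V,
      wt1 σ * (rew c (lderiv K σ) (σ.eval v) + langSum c n (lderiv K σ) (σ.eval v)) := by
  unfold langSum
  have hinj : Function.Injective (fun p : Stmt V × List (Stmt V) => p.1 :: p.2) := by
    rintro ⟨a, b⟩ ⟨a', b'⟩ h
    simpa using h
  rw [← hinj.tsum_eq]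
  · rw [ENNReal.tsum_prod']
    congr 1
    funext σ
    have h0 : rew c (lderiv K σ) (σ.eval v)
        = ∑' τ : List (Stmt V), if τ = [] then rew c (lderiv K σ) (σ.eval v) else 0 := by
      rw [tsum_ite_eq]
    rw [h0, ← ENNReal.tsum_add, ← ENNReal.tsum_mul_left]
    congr 1
    funext τ
    have hev : traceEval (σ :: τ) v = traceEval τ (σ.eval v) := rfl
    simp only [hev, wt_cons, mul_assoc]
    by_cases hτ : τ = []
    · subst hτ
      by_cases hK : [σ] ∈ K <;> simp [rew, lderiv, hK, traceEval, wt]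
    · by_cases hK : σ :: τ ∈ K <;> by_cases hl : τ.length ≤ n <;>
        simp [hτ, lderiv, hK, hl]
  · intro τ hτ
    cases τ with
    | nil => simp at hτ
    | cons σ τ => exact ⟨(σ, τ), rfl⟩

/-- Language accepted from a location (including possibly the empty word). -/
def PAuto.acc (A : PAuto V) (l : A.Loc) : Set (List (Stmt V)) :=
  {τ | ∃ e ∈ A.ending, A.Path l τ e}

theorem PAuto.nil_mem_acc (A : PAuto V) (l : A.Loc) : [] ∈ A.acc l ↔ l ∈ A.ending := by
  constructor
  · rintro ⟨e, he, hp⟩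
    cases hp
    exact he
  · intro h
    exact ⟨l, h, .nil l⟩

theorem PAuto.cons_mem_acc (A : PAuto V) (l : A.Loc) (σ : Stmt V) (τ : List (Stmt V)) :
    σ :: τ ∈ A.acc l ↔ ∃ l', A.trans l σ l' ∧ τ ∈ A.acc l' := by
  constructor
  · rintro ⟨e, he, hp⟩
    cases hp with
    | cons h1 h2 => exact ⟨_, h1, e, he, h2⟩
  · rintro ⟨l', h, e, he, hp⟩
    exact ⟨e, he, .cons h hp⟩

theorem PAuto.lderiv_acc_of_not (A : PAuto V) (l : A.Loc) (σ : Stmt V)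
    (h : ¬ ∃ l', A.trans l σ l') : lderiv (A.acc l) σ = ∅ := by
  ext τ
  simp only [lderiv, Set.mem_setOf_eq, A.cons_mem_acc, Set.mem_empty_iff_false, iff_false]
  rintro ⟨l', h', _⟩
  exact h ⟨l', h'⟩

theorem PAuto.lderiv_acc (A : PAuto V) (hA : A.Det) {l l' : A.Loc} {σ : Stmt V}
    (h : A.trans l σ l') : lderiv (A.acc l) σ = A.acc l' := by
  ext τ
  simp only [lderiv, Set.mem_setOf_eq, A.cons_mem_acc]
  constructor
  · rintro ⟨l'', h', ht⟩
    rwa [hA h h']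
  · intro ht
    exact ⟨l', h, ht⟩

theorem PAuto.applyPolicy_det (A : PAuto V) (hA : A.Det) (ψ : Policy A) :
    (A.applyPolicy ψ).Det := by
  rintro ⟨l, s⟩ σ ⟨l₁, s₁⟩ ⟨l₂, s₂⟩ ⟨h1, h2⟩ ⟨h3, h4⟩
  have := hA h1 h3
  simp only at h2 h4 this
  rw [h2] at h4
  simp at h4
  exact Prod.ext this h4

/-- The derivative in the policy automaton. -/
theorem rew_acc_policy (c : Option (V → ℕ) → ENNReal) (A : PAuto V) (ψ : Policy A)
    (l : A.Loc) (s : ψ.S) (v : Option (V → ℕ)) :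
    rew c ((A.applyPolicy ψ).acc (l, s)) v = rew c (A.acc l) v := by
  unfold rew
  have h : ([] ∈ (A.applyPolicy ψ).acc (l, s)) ↔ [] ∈ A.acc l :=
    ((A.applyPolicy ψ).nil_mem_acc (l, s)).trans (A.nil_mem_acc l).symm
  by_cases h' : [] ∈ A.acc l
  · rw [if_pos h', if_pos (h.mpr h')]
  · rw [if_neg h', if_neg (fun h'' => h' (h.mp h''))]

theorem langSum_le_optVal [DecidableEq V] (c : Option (V → ℕ) → ENNReal) (A : PAuto V)
    (hA : A.Det) (ψ : Policy A) (n : ℕ) :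
    ∀ (l : A.Loc) (s : ψ.S) (v : Option (V → ℕ)),
      langSum c n ((A.applyPolicy ψ).acc (l, s)) v ≤ optVal c n (A.acc l) v := by
  induction n with
  | zero => intro l s v; rw [langSum_zero]; exact zero_le
  | succ n ih =>
    intro l s v
    rw [langSum_succ, optVal_succ]
    rcases hsel : ψ.sel l s with _ | ⟨a, s'⟩
    · have : ∀ σ, lderiv ((A.applyPolicy ψ).acc (l, s)) σ = ∅ := by
        intro σ
        apply PAuto.lderiv_acc_of_not
        rintro ⟨⟨l', s'⟩, _, h⟩
        simp [hsel] at h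
      simp [this, rew_empty, langSum_empty]
    · refine le_trans ?_ (le_iSup _ a)
      unfold actVal
      refine ENNReal.tsum_le_tsum fun σ => ?_
      by_cases hσ : σ.act = a ∧ ∃ l', A.trans l σ l'
      · obtain ⟨ha, l', hl'⟩ := hσ
        have ht : (A.applyPolicy ψ).trans (l, s) σ (l', s') := ⟨hl', by simp [hsel, ha]⟩
        rw [if_pos ha, PAuto.lderiv_acc _ (A.applyPolicy_det hA ψ) ht, A.lderiv_acc hA hl',
          rew_acc_policy]
        gcongr
        exact ih _ _ _
      · have : lderiv ((A.applyPolicy ψ).acc (l, s)) σ = ∅ := by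
          apply PAuto.lderiv_acc_of_not
          rintro ⟨⟨l', s''⟩, h, h'⟩
          simp only [hsel, Option.some.injEq, Prod.mk.injEq] at h'
          exact hσ ⟨h'.1.symm, l', h⟩
        simp [this, rew_empty, langSum_empty]

/-- Effect of an action on the valuation. -/
def Act.step [DecidableEq V] : Act V → Option (V → ℕ) → Option (V → ℕ)
  | .stmt σ, v => σ.eval v
  | .tag _, v => v

theorem Act.step_act [DecidableEq V] (σ : Stmt V) (v : Option (V → ℕ)) :
    σ.act.step v = σ.eval v := by
  cases σ <;> cases v <;> rfl

theorem exists_best [DecidableEq V] (c : Option (V → ℕ) → ENNReal) (A : PAuto V)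
    (alph : Finset (Stmt V)) (hov : A.Over alph) (n : ℕ) (l : A.Loc) (v : Option (V → ℕ)) :
    ∃ a, ∀ a', actVal c n (A.acc l) v a' ≤ actVal c n (A.acc l) v a := by
  obtain ⟨a, _, ha⟩ := Finset.exists_max_image (insert (Act.tag 0) (alph.image Stmt.act))
    (actVal c n (A.acc l) v) ⟨_, Finset.mem_insert_self _ _⟩
  refine ⟨a, fun a' => ?_⟩
  by_cases h : a' ∈ alph.image Stmt.act
  · exact ha _ (Finset.mem_insert_of_mem h)
  · have : actVal c n (A.acc l) v a' = 0 := by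
      unfold actVal
      rw [ENNReal.tsum_eq_zero]
      intro σ
      split_ifs with hσ
      · have : lderiv (A.acc l) σ = ∅ := by
          apply PAuto.lderiv_acc_of_not
          rintro ⟨l', hl'⟩
          exact h (Finset.mem_image.mpr ⟨σ, hov hl', hσ⟩)
        simp [this, rew_empty, optVal_empty]
      · rfl
    rw [this]
    exact zero_le

/-- Finite-horizon policy playing according to a selection function. -/
def horizonPolicy [DecidableEq V] (A : PAuto V)
    (best : ℕ → A.Loc → Option (V → ℕ) → Act V) (N : ℕ) (v₀ : Option (V → ℕ)) : Policy A where
  S := ℕ × Option (V → ℕ)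
  sel := fun l s => match s with
    | (0, _) => none
    | (n + 1, v) => some (best n l v, (n, (best n l v).step v))
  s₀ := (N, v₀)

theorem optVal_le_langSum [DecidableEq V] (c : Option (V → ℕ) → ENNReal) (A : PAuto V)
    (hA : A.Det) (best : ℕ → A.Loc → Option (V → ℕ) → Act V)
    (hbest : ∀ n l v a', actVal c n (A.acc l) v a' ≤ actVal c n (A.acc l) v (best n l v))
    (N : ℕ) (v₀ : Option (V → ℕ)) (n : ℕ) :
    ∀ (l : A.Loc) (v : Option (V → ℕ)),
      optVal c n (A.acc l) v ≤
        langSum c n ((A.applyPolicy (horizonPolicy A best N v₀)).acc (l, (n, v))) v := by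
  induction n with
  | zero => intro l v; exact zero_le
  | succ n ih =>
    intro l v
    rw [langSum_succ, optVal_succ]
    refine (iSup_le (hbest n l v)).trans ?_
    unfold actVal
    refine ENNReal.tsum_le_tsum fun σ => ?_
    split_ifs with ha
    · by_cases hl : ∃ l', A.trans l σ l'
      · obtain ⟨l', hl'⟩ := hl
        have ht : (A.applyPolicy (horizonPolicy A best N v₀)).trans (l, (n + 1, v)) σ
            (l', (n, σ.eval v)) := by
          refine ⟨hl', ?_⟩
          change some (best n l v, (n, (best n l v).step v)) = some (σ.act, (n, σ.eval v))
          rw [← ha, Act.step_act]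
        rw [PAuto.lderiv_acc _ (A.applyPolicy_det hA _) ht, A.lderiv_acc hA hl']
        exact mul_le_mul_right (add_le_add
          (rew_acc_policy c A (horizonPolicy A best N v₀) l' (n, σ.eval v) (σ.eval v)).ge
          (ih _ _)) _
      · rw [A.lderiv_acc_of_not l σ hl]
        simp [rew_empty, optVal_empty]
    · exact zero_le

theorem optVal_acc_init [DecidableEq V] (c : Option (V → ℕ) → ENNReal) (A : PAuto V) (n : ℕ)
    (v : Option (V → ℕ)) : optVal c n (A.acc A.init) v = optVal c n A.lang v := by
  cases n with
  | zero => rfl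
  | succ n =>
    have : ∀ σ, lderiv (A.acc A.init) σ = lderiv A.lang σ := by
      intro σ
      ext τ
      simp [lderiv, PAuto.acc, PAuto.lang]
    simp only [optVal_succ, actVal, this]

theorem tsum_lang [DecidableEq V] (c : Option (V → ℕ) → ENNReal) (A : PAuto V)
    (v : Option (V → ℕ)) :
    ∑' τ : A.lang, wt τ.1 * c (traceEval τ.1 v) = ⨆ n, langSum c n (A.acc A.init) v := by
  rw [tsum_subtype A.lang (fun τ => wt τ * c (traceEval τ v))]
  apply le_antisymm
  · rw [ENNReal.tsum_eq_iSup_sum]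
    refine iSup_le fun s => ?_
    refine le_trans ?_ (le_iSup _ (s.sup List.length))
    unfold langSum
    refine le_trans ?_ (ENNReal.sum_le_tsum s)
    refine Finset.sum_le_sum fun τ hτ => ?_
    have hlen : τ.length ≤ s.sup List.length := Finset.le_sup (f := List.length) hτ
    by_cases h : τ ∈ A.lang
    · rw [Set.indicator_of_mem h, if_pos ⟨h.2, h.1, hlen⟩]
    · rw [Set.indicator_of_notMem h]
      exact zero_le
  · refine iSup_le fun n => ?_
    unfold langSum
    refine ENNReal.tsum_le_tsum fun τ => ?_
    split_ifs with h
    · rw [Set.indicator_of_mem (show τ ∈ A.lang from ⟨h.2.1, h.1⟩)]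
    · exact zero_le

theorem value_eq [DecidableEq V] (c : Option (V → ℕ) → ENNReal) (A : PAuto V)
    (alph : Finset (Stmt V)) (hov : A.Over alph) (hA : A.Det) (v : Option (V → ℕ)) :
    ⨆ ψ : Policy A, ∑' τ : (A.applyPolicy ψ).lang, wt τ.1 * c (traceEval τ.1 v)
      = ⨆ n, optVal c n A.lang v := by
  simp only [tsum_lang, ← optVal_acc_init]
  apply le_antisymm
  · exact iSup_le fun ψ => iSup_mono fun n => langSum_le_optVal c A hA ψ n _ _ v
  · refine iSup_le fun n => ?_
    choose best hbest using exists_best c A alph hov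
    exact (optVal_le_langSum c A hA best hbest n v n A.init v).trans
      ((le_iSup (fun m => langSum c m ((A.applyPolicy (horizonPolicy A best n v)).acc
        (A.applyPolicy (horizonPolicy A best n v)).init) v) n).trans
        (le_iSup (fun ψ : Policy A => ⨆ m, langSum c m ((A.applyPolicy ψ).acc
          (A.applyPolicy ψ).init) v) (horizonPolicy A best n v)))

/-- Deterministic general PCFA over the same statement set with the same
language have equal MDP-view violation probabilities and equal structural bounds. -/
theorem mdpProb_structBound_congr_lang {V : Type} [DecidableEq V]
    (A₁ A₂ : PAuto V) (alph : Finset (Stmt V))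
    (h₁fin : Finite A₁.Loc) (h₁over : A₁.Over alph) (h₁det : A₁.Det)
    (h₂fin : Finite A₂.Loc) (h₂over : A₂.Over alph) (h₂det : A₂.Det)
    (hlang : A₁.lang = A₂.lang) (φe φf : BExp V) :
    mdpProb A₁ φe φf = mdpProb A₂ φe φf ∧ structBound A₁ = structBound A₂ := by
  constructor
  · unfold mdpProb
    refine iSup_congr fun v => iSup_congr fun _ => ?_
    have e₁ := value_eq (fun w => if BExp.sat w (BExp.not φf) then 1 else 0) A₁ alph
      h₁over h₁det v
    have e₂ := value_eq (fun w => if BExp.sat w (BExp.not φf) then 1 else 0) A₂ alph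
      h₂over h₂det v
    rw [e₁, e₂, hlang]
  · unfold structBound
    have e₁ := value_eq (fun _ => 1) A₁ alph h₁over h₁det none
    have e₂ := value_eq (fun _ => 1) A₂ alph h₂over h₂det none
    simp only [mul_one] at e₁ e₂
    rw [e₁, e₂, hlang]
end

section
/- Let M be a single-action automaton in which no ending location has an outgoing transition. Then the total weight of its accepting traces is a sub-probability: Σ_{τ ∈ ℒ(M)} wt(τ) ≤ 1, where the (possibly infinite) sum is taken in [0,∞]. -/
open Classical

variable {V : Type}

def AccFrom {V : Type} (M : PAuto V) (q : M.Loc) (τ : List (Stmt V)) : Prop :=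
  ∃ l ∈ M.ending, M.Path q τ l

theorem sum_cons_le {V : Type} (M : PAuto V) (hdet : M.Det) (n : ℕ)
    (ih : ∀ (q : M.Loc) (S : Finset (List (Stmt V))),
      (∀ τ ∈ S, τ.length ≤ n ∧ AccFrom M q τ) → ∑ τ ∈ S, wt τ ≤ 1)
    (q : M.Loc) (σ : Stmt V) (S : Finset (List (Stmt V)))
    (hS : ∀ τ ∈ S, τ.length ≤ n + 1 ∧ AccFrom M q τ)
    (hσ : ∀ τ ∈ S, ∃ τ', τ = σ :: τ') :
    ∑ τ ∈ S, wt τ ≤ if σ.isProb then 2⁻¹ else 1 := by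
  classical
  rcases S.eq_empty_or_nonempty with rfl | ⟨τ₀, h₀⟩
  · simp
  obtain ⟨τ₁, rfl⟩ := hσ _ h₀
  obtain ⟨_, l₀, hl₀, hp₀⟩ := hS _ h₀
  cases hp₀ with
  | @cons _ q' _ _ _ ht hp =>
  have hinj : Set.InjOn List.tail (S : Set (List (Stmt V))) := by
    intro a ha b hb hab
    obtain ⟨a', rfl⟩ := hσ _ ha
    obtain ⟨b', rfl⟩ := hσ _ hb
    simpa using hab
  have key := ih q' (S.image List.tail) (by
    intro τ hτ
    obtain ⟨ρ, hρ, rfl⟩ := Finset.mem_image.1 hτ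
    obtain ⟨ρ', rfl⟩ := hσ _ hρ
    obtain ⟨hl, l, hle, hpp⟩ := hS _ hρ
    refine ⟨by simpa using hl, l, hle, ?_⟩
    cases hpp with
    | cons ht' hp' => rw [hdet ht ht']; exact hp')
  rw [Finset.sum_image hinj] at key
  have : ∑ τ ∈ S, wt τ = (if σ.isProb then 2⁻¹ else 1) * ∑ τ ∈ S, wt τ.tail := by
    rw [Finset.mul_sum]
    refine Finset.sum_congr rfl fun τ hτ => ?_
    obtain ⟨τ', rfl⟩ := hσ _ hτ
    by_cases h : σ.isProb = true <;> simp [wt, h, pow_succ, mul_comm]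
  rw [this]
  exact (mul_le_mul_right key _).trans (by simp)

theorem sum_acc_le {V : Type} (M : PAuto V) (hM : M.SingleAction)
    (hno : ∀ q ∈ M.ending, ∀ (σ : Stmt V) (q' : M.Loc), ¬ M.trans q σ q') (n : ℕ) :
    ∀ (q : M.Loc) (S : Finset (List (Stmt V))),
      (∀ τ ∈ S, τ.length ≤ n ∧ AccFrom M q τ) → ∑ τ ∈ S, wt τ ≤ 1 := by
  classical
  induction n with
  | zero =>
    intro q S hS
    have : S ⊆ {[]} := fun τ hτ => by simpa using (hS τ hτ).1
    exact (Finset.sum_le_sum_of_subset this).trans (by simp [wt])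
  | succ n ih =>
    intro q S hS
    by_cases hq : q ∈ M.ending
    · have : S ⊆ {[]} := fun τ hτ => by
        obtain ⟨_, l, _, hp⟩ := hS τ hτ
        cases hp with
        | nil => simp
        | cons ht _ => exact absurd ht (hno _ hq _ _)
      exact (Finset.sum_le_sum_of_subset this).trans (by simp [wt])
    · have hc : ∀ τ ∈ S, ∃ σ τ' q', τ = σ :: τ' ∧ M.trans q σ q' := fun τ hτ => by
        obtain ⟨_, l, hl, hp⟩ := hS τ hτ
        cases hp with
        | nil => exact absurd hl hq
        | cons ht _ => exact ⟨_, _, _, rfl, ht⟩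
      rcases hM.2 q with ⟨σ, hσ, h⟩ | ⟨i, h⟩
      · have := sum_cons_le M hM.1 n ih q σ S hS (fun τ hτ => by
          obtain ⟨σ', τ', q', rfl, ht⟩ := hc τ hτ
          exact ⟨τ', by rw [h ht]⟩)
        simpa [hσ] using this
      · have hd : ∀ d, ∑ τ ∈ S with τ.head? = some (Stmt.prob i d), wt τ ≤ 2⁻¹ := fun d => by
          have := sum_cons_le M hM.1 n ih q (Stmt.prob i d)
            (S.filter fun τ => τ.head? = some (Stmt.prob i d))
            (fun τ hτ => hS τ (Finset.mem_filter.1 hτ).1) (fun τ hτ => by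
              obtain ⟨h1, h2⟩ := Finset.mem_filter.1 hτ
              exact ⟨τ.tail, (List.cons_head?_tail h2).symm⟩)
          simpa [Stmt.isProb] using this
        have hsub : S ⊆ (S.filter fun τ => τ.head? = some (Stmt.prob i Dir.L)) ∪
            (S.filter fun τ => τ.head? = some (Stmt.prob i Dir.R)) := fun τ hτ => by
          obtain ⟨σ', τ', q', rfl, ht⟩ := hc τ hτ
          obtain ⟨d, rfl⟩ := h ht
          cases d <;> simp [hτ]
        calc ∑ τ ∈ S, wt τ ≤ _ := Finset.sum_le_sum_of_subset hsub
          _ ≤ _ := le_self_add.trans_eq Finset.sum_union_inter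
          _ ≤ 2⁻¹ + 2⁻¹ := add_le_add (hd _) (hd _)
          _ = 1 := ENNReal.inv_two_add_inv_two

/-- For a single-action automaton whose ending locations have no outgoing
transitions, the total weight of its accepting traces is at most 1. -/
theorem singleAction_wt_le_one {V : Type}
    (M : PAuto V) (alph : Finset (Stmt V)) (hover : M.Over alph)
    (hM : M.SingleAction)
    (hno : ∀ q ∈ M.ending, ∀ (σ : Stmt V) (q' : M.Loc), ¬ M.trans q σ q') :
    ∑' τ : M.lang, wt τ.1 ≤ 1 := by
  rw [ENNReal.tsum_eq_iSup_sum]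
  refine iSup_le fun S => ?_
  have h := sum_acc_le M hM hno
    ((S.map (Function.Embedding.subtype _)).sup List.length) M.init
    (S.map (Function.Embedding.subtype _)) (fun τ hτ => by
      refine ⟨Finset.le_sup (f := List.length) hτ, ?_⟩
      obtain ⟨ρ, _, rfl⟩ := Finset.mem_map.1 hτ
      exact ρ.2.2)
  simpa using h
end
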